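/- (Upper bound on the effective diffusion coefficient.) Assume V ∈ C^∞(𝕋^d). Fix a unit vector e ∈ ℝ^d and suppose φ ∈ C^∞(X), with φ and all its partial derivatives in L²(μ_β), solves the Poisson equation 𝓛 φ = p·e pointwise on X. Then the effective diffusion coefficient D^e := β^{-1} Σ_{j=1}^m α_j ∫_X |∇_{z_j} φ|² dμ_β satisfies D^e ≤ (4/β) Σ_{i=1}^m α_i / λ_i². -/

import Mathlib

open MeasureTheory Real Filter

noncomputable section

/-- The state space `X = 𝕋^d × ℝ^d × ℝ^{dm}`, realised as
`ℝ^d × ℝ^d × (ℝ^d)^m` with functions that are `ℤ^d`-periodic in the first variable. -/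
abbrev Xsp (d m : ℕ) := (Fin d → ℝ) × (Fin d → ℝ) × (Fin m → Fin d → ℝ)

/-- The direction in the `z_j`-block given by the vector `v`. -/
def zdir (d m : ℕ) (j : Fin m) (v : Fin d → ℝ) : Xsp d m :=
  (0, 0, Function.update 0 j v)

/-- The partial derivative `∂_{z_{j,k}} φ`. -/
def pZ (d m : ℕ) (j : Fin m) (k : Fin d) (φ : Xsp d m → ℝ) (x : Xsp d m) : ℝ :=
  fderiv ℝ φ x (zdir d m j (Pi.single k 1))

/-- The partial derivative `∂_{p_k} φ`. -/
def pP (d m : ℕ) (k : Fin d) (φ : Xsp d m → ℝ) (x : Xsp d m) : ℝ :=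
  fderiv ℝ φ x (0, Pi.single k 1, 0)

/-- The partial derivative `∂_{q_k} φ`. -/
def pQ (d m : ℕ) (k : Fin d) (φ : Xsp d m → ℝ) (x : Xsp d m) : ℝ :=
  fderiv ℝ φ x (Pi.single k 1, 0, 0)

/-- The operator `𝓛` (negative of the generator of the Markovian GLE dynamics):
`𝓛φ = −p·∇_qφ + ∇V·∇_pφ − Σ_j λ_j z_j·∇_pφ + Σ_j λ_j p·∇_{z_j}φ
      + Σ_j α_j z_j·∇_{z_j}φ − β⁻¹ Σ_j α_j Δ_{z_j}φ`. -/
def gen (d m : ℕ) (β : ℝ) (α lam : Fin m → ℝ) (V : (Fin d → ℝ) → ℝ)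
    (φ : Xsp d m → ℝ) (x : Xsp d m) : ℝ :=
  - fderiv ℝ φ x (x.2.1, 0, 0)
  + fderiv ℝ φ x (0, (fun i => fderiv ℝ V x.1 (Pi.single i 1)), 0)
  - fderiv ℝ φ x (0, ∑ j, lam j • x.2.2 j, 0)
  + ∑ j, lam j * fderiv ℝ φ x (zdir d m j x.2.1)
  + ∑ j, α j * fderiv ℝ φ x (zdir d m j (x.2.2 j))
  - β⁻¹ * ∑ j, α j * ∑ k, fderiv ℝ (pZ d m j k φ) x (zdir d m j (Pi.single k 1))

/-- The (unnormalised) Gibbs density `exp(−β(V(q) + |p|²/2 + |z|²/2))`. -/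
def gdens (d m : ℕ) (β : ℝ) (V : (Fin d → ℝ) → ℝ) (x : Xsp d m) : ℝ :=
  Real.exp (-β * (V x.1 + (∑ i, (x.2.1 i) ^ 2) / 2 + (∑ j, ∑ i, (x.2.2 j i) ^ 2) / 2))

/-- The fundamental domain `[0,1)^d` for the torus in the `q`-variable. -/
def cube (d : ℕ) : Set (Fin d → ℝ) := {q | ∀ i, q i ∈ Set.Ico (0 : ℝ) 1}

/-- Lebesgue measure on `X = 𝕋^d × ℝ^d × ℝ^{dm}` (the `q`-variable being
restricted to a fundamental domain of the torus). -/
def volX (d m : ℕ) : Measure (Xsp d m) :=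
  (volume : Measure (Xsp d m)).restrict {x | x.1 ∈ cube d}

/-- The Gibbs measure `μ_β`, with density `Z⁻¹ exp(−β(V(q)+|p|²/2+|z|²/2))`. -/
def gibbs (d m : ℕ) (β Z : ℝ) (V : (Fin d → ℝ) → ℝ) : Measure (Xsp d m) :=
  (volX d m).withDensity fun x => ENNReal.ofReal (Z⁻¹ * gdens d m β V x)

/-- `ℤ^d`-periodicity in the `q`-variable. -/
def PerQ (d m : ℕ) (φ : Xsp d m → ℝ) : Prop :=
  ∀ (k : Fin d → ℤ) (x : Xsp d m), φ (x.1 + (fun i => (k i : ℝ)), x.2) = φ x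

/-- `ℤ^d`-periodicity of the potential. -/
def PerV (d : ℕ) (V : (Fin d → ℝ) → ℝ) : Prop :=
  ∀ (k : Fin d → ℤ) (q : Fin d → ℝ), V (q + fun i => (k i : ℝ)) = V q

/-- A test function: smooth, periodic in `q`, compactly supported in `(p,z)`. -/
def IsTest (d m : ℕ) (φ : Xsp d m → ℝ) : Prop :=
  ContDiff ℝ (⊤ : ℕ∞) φ ∧ PerQ d m φ ∧
    ∃ K : Set ((Fin d → ℝ) × (Fin m → Fin d → ℝ)),
      IsCompact K ∧ ∀ x : Xsp d m, x.2 ∉ K → φ x = 0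

/-- `F` is `μ`-integrable with vanishing integral. -/
def NullMean {Ω : Type*} [MeasurableSpace Ω] (μ : Measure Ω) (F : Ω → ℝ) : Prop :=
  Integrable F μ ∧ ∫ x, F x ∂μ = 0

namespace NullMean

variable {Ω : Type*} [MeasurableSpace Ω] {μ : Measure Ω} {F G : Ω → ℝ}

lemma add (hF : NullMean μ F) (hG : NullMean μ G) : NullMean μ (fun x => F x + G x) :=
  ⟨hF.1.add hG.1, by rw [integral_add hF.1 hG.1, hF.2, hG.2, add_zero]⟩

lemma const_mul (c : ℝ) (hF : NullMean μ F) : NullMean μ (fun x => c * F x) :=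
  ⟨hF.1.const_mul c, by rw [integral_const_mul, hF.2, mul_zero]⟩

lemma sum {ι : Type*} {s : Finset ι} {H : ι → Ω → ℝ} (h : ∀ i ∈ s, NullMean μ (H i)) :
    NullMean μ (fun x => ∑ i ∈ s, H i x) :=
  ⟨integrable_finsetSum s fun i hi => (h i hi).1, by
    rw [integral_finsetSum s fun i hi => (h i hi).1]
    exact Finset.sum_eq_zero fun i hi => (h i hi).2⟩

end NullMean

section Volume

lemma cube_eq_pi (d : ℕ) :
    cube d = Set.pi Set.univ fun i => Set.Ico ((0 : Fin d → ℝ) i) ((1 : Fin d → ℝ) i) := by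
  ext q; simp [cube]

lemma measurableSet_cube (d : ℕ) : MeasurableSet (cube d) := by
  rw [cube_eq_pi]
  exact MeasurableSet.univ_pi fun i => measurableSet_Ico

lemma cube_subset_Icc (d : ℕ) : cube d ⊆ Set.Icc 0 1 :=
  fun _ hq => ⟨fun i => (hq i).1, fun i => (hq i).2.le⟩

lemma cube_ae_eq_Icc (d : ℕ) : cube d =ᵐ[volume] Set.Icc 0 1 := by
  rw [cube_eq_pi]
  exact Measure.univ_pi_Ico_ae_eq_Icc

variable {d m : ℕ}

lemma volX_eq_prod :
    volX d m = ((volume : Measure (Fin d → ℝ)).restrict (cube d)).prod volume := by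
  have h : ({x | x.1 ∈ cube d} : Set (Xsp d m)) = cube d ×ˢ Set.univ := by
    ext x; simp
  rw [volX, h, Measure.volume_eq_prod, ← Measure.prod_restrict, Measure.restrict_univ]

lemma measurableSet_fst_mem_cube : MeasurableSet {x : Xsp d m | x.1 ∈ cube d} :=
  measurable_fst (measurableSet_cube d)

lemma integrable_volX_of_compact {f : Xsp d m → ℝ} (hf : Continuous f)
    {K : Set ((Fin d → ℝ) × (Fin m → Fin d → ℝ))} (hK : IsCompact K)
    (h0 : ∀ x : Xsp d m, x.2 ∉ K → f x = 0) : Integrable f (volX d m) := by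
  have h1 : IntegrableOn f ((Set.Icc (0 : Fin d → ℝ) 1) ×ˢ K) volume :=
    hf.continuousOn.integrableOn_compact (isCompact_Icc.prod hK)
  refine h1.of_forall_sdiff_eq_zero measurableSet_fst_mem_cube fun x hx => h0 x fun hxK => ?_
  exact hx.2 ⟨cube_subset_Icc d hx.1, hxK⟩

lemma fderiv_eq_zero_of_compact {f : Xsp d m → ℝ}
    {K : Set ((Fin d → ℝ) × (Fin m → Fin d → ℝ))} (hK : IsCompact K)
    (h0 : ∀ x : Xsp d m, x.2 ∉ K → f x = 0) {x : Xsp d m} (hx : x.2 ∉ K) :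
    fderiv ℝ f x = 0 := by
  have hU : {y : Xsp d m | y.2 ∉ K} ∈ nhds x :=
    (hK.isClosed.isOpen_compl.preimage continuous_snd).mem_nhds hx
  have : f =ᶠ[nhds x] fun _ => 0 := by
    filter_upwards [hU] with y hy using h0 y hy
  rw [this.fderiv_eq]; simp

lemma integral_fderiv_eq_zero {E : Type*} [NormedAddCommGroup E] [NormedSpace ℝ E]
    [FiniteDimensional ℝ E] [MeasurableSpace E] [BorelSpace E] (μ : Measure E) [μ.IsAddHaarMeasure]
    {f : E → ℝ} (hf : ContDiff ℝ 1 f) (hc : HasCompactSupport f) (w : E) :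
    ∫ y, fderiv ℝ f y w ∂μ = 0 := by
  have h1 : Integrable f μ := hf.continuous.integrable_of_hasCompactSupport hc
  have h2 : Integrable (fun y => fderiv ℝ f y w) μ := by
    refine Continuous.integrable_of_hasCompactSupport ?_ (hc.fderiv_apply (𝕜 := ℝ) w)
    exact (hf.continuous_fderiv one_ne_zero).clm_apply continuous_const
  have := integral_mul_fderiv_eq_neg_fderiv_mul_of_integrable (μ := μ) (f := fun _ : E => (1 : ℝ))
    (g := f) (v := w) (by simp) (by simpa using h2) (by simpa using h1)
    (fun x _ => differentiableAt_const _) (fun x _ => hf.differentiable one_ne_zero x)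
  simpa using this

lemma setIntegral_cube_fderiv_eq_zero {n : ℕ} {g : (Fin (n + 1) → ℝ) → ℝ} (hg : ContDiff ℝ 1 g)
    (hper : PerV (n + 1) g) (k : Fin (n + 1)) :
    ∫ q in cube (n + 1), fderiv ℝ g q (Pi.single k 1) = 0 := by
  rw [setIntegral_congr_set (cube_ae_eq_Icc _)]
  have hcont : Continuous fun q => fderiv ℝ g q (Pi.single k 1) :=
    (hg.continuous_fderiv one_ne_zero).clm_apply continuous_const
  have hsum : ∀ q, ∑ i, (if i = k then fderiv ℝ g q else 0) (Pi.single i 1)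
      = fderiv ℝ g q (Pi.single k 1) := fun q => by
    rw [Finset.sum_eq_single k] <;> simp +contextual
  have := integral_divergence_of_hasFDerivAt_off_countable' (E := ℝ) (0 : Fin (n + 1) → ℝ) 1
    (zero_le_one) (fun i => if i = k then g else 0)
    (fun i q => if i = k then fderiv ℝ g q else 0) ∅ Set.countable_empty
    (fun i => by
      split_ifs
      · exact hg.continuous.continuousOn
      · exact continuousOn_const)
    (fun q _ i => by
      split_ifs
      · exact (hg.differentiable one_ne_zero q).hasFDerivAt
      · exact hasFDerivAt_const 0 q)
    (by
      simp_rw [hsum]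
      exact hcont.continuousOn.integrableOn_compact isCompact_Icc)
  simp_rw [hsum] at this
  rw [this]
  refine Finset.sum_eq_zero fun i _ => sub_eq_zero.2 ?_
  by_cases hi : i = k
  · subst hi
    simp only [if_true]
    congr 1
    funext q
    have h := hper (Pi.single i 1) (i.insertNth 0 q)
    simp only [Pi.zero_apply, Pi.one_apply]
    rw [← h]
    congr 1
    funext l
    refine Fin.succAboveCases i ?_ (fun l => ?_) l <;> simp
  · simp [hi]

lemma nullMean_fderiv_fiber {f : Xsp d m → ℝ} (hf : ContDiff ℝ 1 f)
    {K : Set ((Fin d → ℝ) × (Fin m → Fin d → ℝ))} (hK : IsCompact K)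
    (h0 : ∀ x : Xsp d m, x.2 ∉ K → f x = 0) (w : (Fin d → ℝ) × (Fin m → Fin d → ℝ)) :
    NullMean (volX d m) fun x => fderiv ℝ f x (0, w) := by
  have hint : Integrable (fun x => fderiv ℝ f x (0, w)) (volX d m) :=
    integrable_volX_of_compact ((hf.continuous_fderiv one_ne_zero).clm_apply continuous_const) hK
      fun x hx => by rw [fderiv_eq_zero_of_compact hK h0 hx]; rfl
  refine ⟨hint, ?_⟩
  rw [volX_eq_prod] at hint ⊢
  rw [integral_prod _ hint]
  refine integral_eq_zero_of_ae (Eventually.of_forall fun q => ?_)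
  have hq : ContDiff ℝ 1 fun y => f (q, y) := hf.comp (contDiff_prodMk_right q)
  have hder : ∀ y, fderiv ℝ (fun y => f (q, y)) y w = fderiv ℝ f (q, y) (0, w) := fun y => by
    have := ((hf.differentiable one_ne_zero (q, y)).hasFDerivAt).comp y
      (hasFDerivAt_prodMk_right q y)
    rw [show (fun y => f (q, y)) = f ∘ fun y => (q, y) from rfl, this.fderiv]
    simp
  simp only [Pi.zero_apply, ← hder]
  have : (volume : Measure (Fin m → Fin d → ℝ)).IsAddHaarMeasure :=
    Measure.pi.isAddHaarMeasure _
  have : (volume : Measure ((Fin d → ℝ) × (Fin m → Fin d → ℝ))).IsAddHaarMeasure :=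
    inferInstanceAs (Measure.prod volume volume).IsAddHaarMeasure
  exact integral_fderiv_eq_zero volume hq
    (HasCompactSupport.intro hK fun y hy => h0 (q, y) hy) w

lemma nullMean_fderiv_base {n : ℕ} {f : Xsp (n + 1) m → ℝ} (hf : ContDiff ℝ 1 f)
    (hper : PerQ (n + 1) m f)
    {K : Set ((Fin (n + 1) → ℝ) × (Fin m → Fin (n + 1) → ℝ))} (hK : IsCompact K)
    (h0 : ∀ x : Xsp (n + 1) m, x.2 ∉ K → f x = 0) (k : Fin (n + 1)) :
    NullMean (volX (n + 1) m) fun x => fderiv ℝ f x (Pi.single k 1, 0) := by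
  have hint : Integrable (fun x => fderiv ℝ f x (Pi.single k 1, 0)) (volX (n + 1) m) :=
    integrable_volX_of_compact ((hf.continuous_fderiv one_ne_zero).clm_apply continuous_const) hK
      fun x hx => by rw [fderiv_eq_zero_of_compact hK h0 hx]; rfl
  refine ⟨hint, ?_⟩
  rw [volX_eq_prod] at hint ⊢
  rw [integral_prod_symm _ hint]
  refine integral_eq_zero_of_ae (Eventually.of_forall fun y => ?_)
  have hq : ContDiff ℝ 1 fun q => f (q, y) := hf.comp (contDiff_prodMk_left y)
  have hder : ∀ q, fderiv ℝ (fun q => f (q, y)) q (Pi.single k 1)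
      = fderiv ℝ f (q, y) (Pi.single k 1, 0) := fun q => by
    have := HasFDerivAt.comp (g := f) (f := fun q => (q, y)) q
      (hf.differentiable one_ne_zero (q, y)).hasFDerivAt (hasFDerivAt_prodMk_left q y)
    rw [show (fun q => f (q, y)) = f ∘ fun q => (q, y) from rfl, this.fderiv]
    simp
  simp only [Pi.zero_apply, ← hder]
  exact setIntegral_cube_fderiv_eq_zero hq (fun l q => hper l (q, y)) k

end Volume

section Calculus

variable {d m : ℕ}

lemma fderiv_fun_mul_apply {E : Type*} [NormedAddCommGroup E] [NormedSpace ℝ E] {f g : E → ℝ}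
    {x : E} (hf : DifferentiableAt ℝ f x) (hg : DifferentiableAt ℝ g x) (v : E) :
    fderiv ℝ (fun y => f y * g y) x v = f x * fderiv ℝ g x v + fderiv ℝ f x v * g x := by
  rw [fderiv_fun_mul hf hg]
  simp [mul_comm]

lemma fderiv_apply_eq_zero_of_invariant {E : Type*} [NormedAddCommGroup E] [NormedSpace ℝ E]
    {c : E → ℝ} {x v : E} (hc : DifferentiableAt ℝ c x) (h : ∀ t : ℝ, c (x + t • v) = c x) :
    fderiv ℝ c x v = 0 := by
  rw [← hc.lineDeriv_eq_fderiv, lineDeriv]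
  simp [h]

lemma zdir_eq_sum (j : Fin m) (v : Fin d → ℝ) :
    zdir d m j v = ∑ k, v k • zdir d m j (Pi.single k 1) := by
  refine Prod.ext ?_ (Prod.ext ?_ ?_)
  · simp [zdir, Prod.fst_sum]
  · simp [zdir, Prod.fst_sum, Prod.snd_sum]
  · funext l k
    simp only [zdir, Prod.snd_sum, Prod.smul_snd, Finset.sum_apply, Pi.smul_apply]
    by_cases h : l = j
    · subst h; simp [Pi.single_apply]
    · simp [h]

/-- The Hamiltonian (first order, volume preserving) part of `𝓛`. -/
def ham (lam : Fin m → ℝ) (V : (Fin d → ℝ) → ℝ) (x : Xsp d m) : Xsp d m :=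
  (-x.2.1, (fun i => fderiv ℝ V x.1 (Pi.single i 1)) - ∑ j, lam j • x.2.2 j,
    fun j => lam j • x.2.1)

lemma ham_eq_sum (lam : Fin m → ℝ) (V : (Fin d → ℝ) → ℝ) (x : Xsp d m) :
    ham lam V x = (-x.2.1, 0, 0) + (0, fun i => fderiv ℝ V x.1 (Pi.single i 1), 0)
      - (0, ∑ j, lam j • x.2.2 j, 0) + ∑ j, lam j • zdir d m j x.2.1 := by
  refine Prod.ext ?_ (Prod.ext ?_ ?_)
  · simp [zdir, ham, Prod.fst_sum]
  · simp [zdir, ham, Prod.fst_sum, Prod.snd_sum]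
  · funext l k
    simp [zdir, ham, Prod.snd_sum, Finset.sum_apply, Function.update_apply]

lemma gen_eq (β : ℝ) (α lam : Fin m → ℝ) (V : (Fin d → ℝ) → ℝ) (φ : Xsp d m → ℝ) (x : Xsp d m) :
    gen d m β α lam V φ x = fderiv ℝ φ x (ham lam V x)
      + ∑ j, α j * ∑ k, (x.2.2 j k * pZ d m j k φ x
        - β⁻¹ * fderiv ℝ (pZ d m j k φ) x (zdir d m j (Pi.single k 1))) := by
  have h1 : fderiv ℝ φ x (-x.2.1, 0, 0) = - fderiv ℝ φ x (x.2.1, 0, 0) := by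
    rw [← map_neg]; simp
  have h2 : ∀ j, fderiv ℝ φ x (zdir d m j (x.2.2 j)) = ∑ k, x.2.2 j k * pZ d m j k φ x := by
    intro j
    rw [zdir_eq_sum, map_sum]
    simp [pZ]
  rw [gen, ham_eq_sum, map_add, map_sub, map_add, map_sum, h1]
  simp only [h2, map_smul, smul_eq_mul, Finset.sum_sub_distrib, mul_sub, Finset.mul_sum]
  have h3 : ∀ j k, β⁻¹ * (α j * fderiv ℝ (pZ d m j k φ) x (zdir d m j (Pi.single k 1)))
      = α j * (β⁻¹ * fderiv ℝ (pZ d m j k φ) x (zdir d m j (Pi.single k 1))) :=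
    fun j k => by ring
  simp only [h3]
  ring

lemma fderiv_ham_eq_sum (lam : Fin m → ℝ) (V : (Fin d → ℝ) → ℝ) (g : Xsp d m → ℝ) (x : Xsp d m) :
    fderiv ℝ g x (ham lam V x) = (∑ k, -(x.2.1 k) * fderiv ℝ g x (Pi.single k 1, 0))
      + (∑ k, (fderiv ℝ V x.1 (Pi.single k 1) - ∑ j, lam j * x.2.2 j k)
          * fderiv ℝ g x (0, Pi.single k 1, 0))
      + ∑ j, ∑ k, (lam j * x.2.1 k) * fderiv ℝ g x (zdir d m j (Pi.single k 1)) := by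
  have hv : ham lam V x = (∑ k, -(x.2.1 k) • ((Pi.single k 1, 0) : Xsp d m))
      + (∑ k, (fderiv ℝ V x.1 (Pi.single k 1) - ∑ j, lam j * x.2.2 j k)
          • ((0, Pi.single k 1, 0) : Xsp d m))
      + ∑ j, ∑ k, (lam j * x.2.1 k) • zdir d m j (Pi.single k 1) := by
    simp only [mul_smul, ← Finset.smul_sum, ← zdir_eq_sum]
    refine Prod.ext ?_ (Prod.ext ?_ ?_)
    · funext l
      simp [zdir, ham, Prod.fst_sum, Finset.sum_apply, Pi.single_apply]
    · funext l
      simp [zdir, ham, Prod.fst_sum, Prod.snd_sum, Finset.sum_apply, Pi.single_apply]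
    · funext l k
      simp [zdir, ham, Prod.snd_sum, Finset.sum_apply, Function.update_apply]
  rw [hv, map_add, map_add, map_sum, map_sum, map_sum]
  simp only [map_sum, map_smul, map_neg, neg_smul, smul_eq_mul, neg_mul]

lemma contDiff_gdens (β : ℝ) {V : (Fin d → ℝ) → ℝ} (hV : ContDiff ℝ (⊤ : ℕ∞) V) :
    ContDiff ℝ (⊤ : ℕ∞) (gdens d m β V) := by
  unfold gdens
  have := hV.comp (contDiff_fst (𝕜 := ℝ) (E := Fin d → ℝ)
    (F := (Fin d → ℝ) × (Fin m → Fin d → ℝ)))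
  simp only [Function.comp_def] at this
  fun_prop

lemma gdens_pos (β : ℝ) (V : (Fin d → ℝ) → ℝ) (x : Xsp d m) : 0 < gdens d m β V x :=
  Real.exp_pos _

lemma perQ_gdens (β : ℝ) {V : (Fin d → ℝ) → ℝ} (hV : PerV d V) : PerQ d m (gdens d m β V) :=
  fun k x => by simp only [gdens, hV k x.1]

/-- The coordinate `z_{j,k}` as a continuous linear functional. -/
def zcoord (d m : ℕ) (j : Fin m) (k : Fin d) : Xsp d m →L[ℝ] ℝ :=
  (ContinuousLinearMap.proj (R := ℝ) (φ := fun _ : Fin d => ℝ) k).comp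
    ((ContinuousLinearMap.proj (R := ℝ) (φ := fun _ : Fin m => Fin d → ℝ) j).comp
      ((ContinuousLinearMap.snd ℝ (Fin d → ℝ) (Fin m → Fin d → ℝ)).comp
        (ContinuousLinearMap.snd ℝ (Fin d → ℝ) _)))

@[simp]
lemma zcoord_apply (j : Fin m) (k : Fin d) (x : Xsp d m) : zcoord d m j k x = x.2.2 j k := rfl

lemma fderiv_gdens (β : ℝ) {V : (Fin d → ℝ) → ℝ} (hV : ContDiff ℝ (⊤ : ℕ∞) V) (x v : Xsp d m) :
    fderiv ℝ (gdens d m β V) x v = gdens d m β V x * (-β * (fderiv ℝ V x.1 v.1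
      + ∑ i, x.2.1 i * v.2.1 i + ∑ j, ∑ i, x.2.2 j i * v.2.2 j i)) := by
  have hV' : HasFDerivAt (fun x : Xsp d m => V x.1) ((fderiv ℝ V x.1).comp
      (ContinuousLinearMap.fst ℝ _ _)) x :=
    HasFDerivAt.comp (g := V) (f := Prod.fst) x
      (hV.differentiable (by simp) x.1).hasFDerivAt hasFDerivAt_fst
  have hp : ∀ i, HasFDerivAt (fun x : Xsp d m => x.2.1 i) ((ContinuousLinearMap.proj i).comp
      ((ContinuousLinearMap.fst ℝ _ _).comp (ContinuousLinearMap.snd ℝ _ _))) x :=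
    fun i => ContinuousLinearMap.hasFDerivAt ((ContinuousLinearMap.proj i).comp
      ((ContinuousLinearMap.fst ℝ (Fin d → ℝ) (Fin m → Fin d → ℝ)).comp
        (ContinuousLinearMap.snd ℝ (Fin d → ℝ) _)))
  have hz : ∀ j i, HasFDerivAt (fun x : Xsp d m => x.2.2 j i) (zcoord d m j i) x :=
    fun j i => (zcoord d m j i).hasFDerivAt
  have h := ((((hV'.fun_add ((HasFDerivAt.fun_sum (u := Finset.univ)
    fun i _ => (hp i).pow 2).mul_const 2⁻¹)).fun_add
    ((HasFDerivAt.fun_sum (u := Finset.univ) fun j _ => HasFDerivAt.fun_sum (u := Finset.univ)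
      fun i _ => (hz j i).pow 2).mul_const 2⁻¹)).const_mul (-β))).exp
  have hg : gdens d m β V = fun x => Real.exp (-β * (V x.1 + (∑ i, (x.2.1 i) ^ 2) * 2⁻¹
      + (∑ j, ∑ i, (x.2.2 j i) ^ 2) * 2⁻¹)) := by
    funext y; simp only [gdens, div_eq_mul_inv]
  rw [hg, HasFDerivAt.fderiv h]
  simp [← Finset.mul_sum, mul_assoc]
  ring

lemma fderiv_gdens_ham (β : ℝ) (lam : Fin m → ℝ) {V : (Fin d → ℝ) → ℝ}
    (hV : ContDiff ℝ (⊤ : ℕ∞) V) (x : Xsp d m) :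
    fderiv ℝ (gdens d m β V) x (ham lam V x) = 0 := by
  have h1 : fderiv ℝ V x.1 x.2.1 = ∑ k, x.2.1 k * fderiv ℝ V x.1 (Pi.single k 1) := by
    conv_lhs => rw [← Finset.univ_sum_single x.2.1, map_sum]
    refine Finset.sum_congr rfl fun k _ => ?_
    rw [← smul_eq_mul, ← map_smul, ← Pi.single_smul]; simp
  have h2 : ∑ j, ∑ i, x.2.2 j i * (lam j * x.2.1 i)
      = ∑ i, x.2.1 i * ∑ j, lam j * x.2.2 j i := by
    rw [Finset.sum_comm]
    refine Finset.sum_congr rfl fun i _ => ?_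
    rw [Finset.mul_sum]
    exact Finset.sum_congr rfl fun j _ => by ring
  rw [fderiv_gdens β hV]
  simp only [ham, map_neg, h1, Pi.sub_apply, Finset.sum_apply, Pi.smul_apply, smul_eq_mul, h2,
    mul_sub, Finset.sum_sub_distrib]
  ring

lemma fderiv_gdens_zdir (β : ℝ) {V : (Fin d → ℝ) → ℝ} (hV : ContDiff ℝ (⊤ : ℕ∞) V) (x : Xsp d m)
    (j : Fin m) (k : Fin d) :
    fderiv ℝ (gdens d m β V) x (zdir d m j (Pi.single k 1))
      = -β * x.2.2 j k * gdens d m β V x := by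
  have h : ∑ l, ∑ i, x.2.2 l i * (Function.update (0 : Fin m → Fin d → ℝ) j (Pi.single k 1)) l i
      = x.2.2 j k := by
    rw [Finset.sum_eq_single j (fun l _ hl => by simp [hl]) (by simp)]
    simp [Pi.single_apply]
  rw [fderiv_gdens β hV]
  simp only [zdir, map_zero, h, Pi.zero_apply, mul_zero, Finset.sum_const_zero]
  ring

lemma nullMean_mul_fderiv_fiber {c f : Xsp d m → ℝ} (hc : ContDiff ℝ 1 c) (hf : ContDiff ℝ 1 f)
    {K : Set ((Fin d → ℝ) × (Fin m → Fin d → ℝ))} (hK : IsCompact K)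
    (h0 : ∀ x : Xsp d m, x.2 ∉ K → f x = 0) (w : (Fin d → ℝ) × (Fin m → Fin d → ℝ))
    (hcw : ∀ (x : Xsp d m) (t : ℝ), c (x + t • (0, w)) = c x) :
    NullMean (volX d m) fun x => c x * fderiv ℝ f x (0, w) := by
  have h := nullMean_fderiv_fiber (hc.mul hf) hK (fun x hx => by simp [h0 x hx]) w
  convert h using 2 with x
  have hcx := hc.differentiable one_ne_zero x
  rw [fderiv_fun_mul_apply hcx (hf.differentiable one_ne_zero x),
    fderiv_apply_eq_zero_of_invariant hcx (hcw x)]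
  ring

lemma nullMean_mul_fderiv_base {n : ℕ} {c f : Xsp (n + 1) m → ℝ} (hc : ContDiff ℝ 1 c)
    (hf : ContDiff ℝ 1 f) (hcper : PerQ (n + 1) m c) (hper : PerQ (n + 1) m f)
    {K : Set ((Fin (n + 1) → ℝ) × (Fin m → Fin (n + 1) → ℝ))} (hK : IsCompact K)
    (h0 : ∀ x : Xsp (n + 1) m, x.2 ∉ K → f x = 0) (k : Fin (n + 1))
    (hcw : ∀ (x : Xsp (n + 1) m) (t : ℝ), c (x + t • (Pi.single k 1, 0)) = c x) :
    NullMean (volX (n + 1) m) fun x => c x * fderiv ℝ f x (Pi.single k 1, 0) := by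
  have h := nullMean_fderiv_base (hc.mul hf)
    (fun l x => by simp only [hcper l x, hper l x]) hK (fun x hx => by simp [h0 x hx]) k
  convert h using 2 with x
  have hcx := hc.differentiable one_ne_zero x
  rw [fderiv_fun_mul_apply hcx (hf.differentiable one_ne_zero x),
    fderiv_apply_eq_zero_of_invariant hcx (hcw x)]
  ring

/-- The Hamiltonian flow preserves Lebesgue measure. -/
lemma nullMean_fderiv_ham {n : ℕ} (lam : Fin m → ℝ) {V : (Fin (n + 1) → ℝ) → ℝ}
    (hV : ContDiff ℝ (⊤ : ℕ∞) V) {f : Xsp (n + 1) m → ℝ} (hf : ContDiff ℝ 1 f)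
    (hper : PerQ (n + 1) m f)
    {K : Set ((Fin (n + 1) → ℝ) × (Fin m → Fin (n + 1) → ℝ))} (hK : IsCompact K)
    (h0 : ∀ x : Xsp (n + 1) m, x.2 ∉ K → f x = 0) :
    NullMean (volX (n + 1) m) fun x => fderiv ℝ f x (ham lam V x) := by
  simp only [fderiv_ham_eq_sum]
  refine ((NullMean.sum fun k _ => ?_).add (NullMean.sum fun k _ => ?_)).add
    (NullMean.sum fun j _ => NullMean.sum fun k _ => ?_)
  · refine nullMean_mul_fderiv_base (c := fun x => -(x.2.1 k)) (by fun_prop) hf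
      (fun l x => rfl) hper hK h0 k fun x t => by simp
  · have h1 : ContDiff ℝ 1 fun q => fderiv ℝ V q (Pi.single k 1) :=
      (hV.fderiv_right (m := 1) (by norm_cast)).clm_apply contDiff_const
    have h2 : ContDiff ℝ 1 fun x : Xsp (n + 1) m => fderiv ℝ V x.1 (Pi.single k 1) :=
      h1.comp contDiff_fst
    refine nullMean_mul_fderiv_fiber
      (c := fun x => fderiv ℝ V x.1 (Pi.single k 1) - ∑ j, lam j * x.2.2 j k)
      (by fun_prop) hf hK h0 (Pi.single k 1, 0) fun x t => by simp
  · exact nullMean_mul_fderiv_fiber (c := fun x => lam j * x.2.1 k) (by fun_prop) hf hK h0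
      (0, Function.update 0 j (Pi.single k 1)) fun x t => by simp

end Calculus

section Cutoff

lemma exists_cutoff (E : Type*) [NormedAddCommGroup E] [NormedSpace ℝ E] [FiniteDimensional ℝ E] :
    ∃ (χ : ℕ → E → ℝ) (C : ℝ), (∀ n, ContDiff ℝ 1 (χ n)) ∧ (∀ n, HasCompactSupport (χ n)) ∧
      (∀ n y, |χ n y| ≤ 1) ∧ (∀ y, Tendsto (fun n => χ n y) atTop (nhds 1)) ∧
      (∀ n y, ‖fderiv ℝ (χ n) y‖ * (1 + ‖y‖) ≤ C) ∧
      ∀ y, Tendsto (fun n => fderiv ℝ (χ n) y) atTop (nhds 0) := by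
  let b : ContDiffBump (0 : E) := ⟨1, 2, one_pos, one_lt_two⟩
  have hb : ContDiff ℝ 1 b := b.contDiff
  have hb' : Continuous (fderiv ℝ b) := hb.continuous_fderiv one_ne_zero
  obtain ⟨C, hC⟩ := (b.hasCompactSupport.fderiv (𝕜 := ℝ)).norm.mul_right
    (f' := fun y => 1 + ‖y‖) |>.exists_bound_of_continuous (by fun_prop)
  have hC' : ∀ y, ‖fderiv ℝ b y‖ * (1 + ‖y‖) ≤ C := fun y => (le_abs_self _).trans (hC y)
  have hC1 : ∀ y, ‖fderiv ℝ b y‖ ≤ C := fun y =>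
    (le_mul_of_one_le_right (norm_nonneg _) (by linarith [norm_nonneg y])).trans (hC' y)
  let s : ℕ → ℝ := fun n => ((n : ℝ) + 1)⁻¹
  have hs0 : ∀ n, 0 < s n := fun n => by positivity
  have hs1 : ∀ n, s n ≤ 1 := fun n => inv_le_one_of_one_le₀ (by linarith [n.cast_nonneg (α := ℝ)])
  have hst : Tendsto s atTop (nhds 0) := by
    simpa [s, one_div] using tendsto_one_div_add_atTop_nhds_zero_nat (𝕜 := ℝ)
  have hder : ∀ n y, fderiv ℝ (fun y => b (s n • y)) y = s n • fderiv ℝ b (s n • y) :=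
    fun n y => by
      have := HasFDerivAt.comp (g := b) (f := fun y : E => s n • y) y
        (hb.differentiable one_ne_zero (s n • y)).hasFDerivAt ((hasFDerivAt_id y).const_smul (s n))
      rw [show (fun y => b (s n • y)) = b ∘ fun y : E => s n • y from rfl, this.fderiv]
      ext w; simp
  refine ⟨fun n y => b (s n • y), C, fun n => hb.comp (contDiff_const_smul _), fun n => ?_,
    fun n y => ?_, fun y => ?_, fun n y => ?_, fun y => ?_⟩
  · exact b.hasCompactSupport.comp_smul (hs0 n).ne'
  · rw [abs_of_nonneg b.nonneg]; exact b.le_one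
  · have h : Tendsto (fun n => b (s n • y)) atTop (nhds (b ((0 : ℝ) • y))) :=
      (hb.continuous.tendsto _).comp (hst.smul_const y)
    rwa [zero_smul, b.one_of_mem_closedBall (by simp [b])] at h
  · rw [hder, norm_smul, Real.norm_of_nonneg (hs0 n).le]
    refine le_trans ?_ (hC' (s n • y))
    rw [norm_smul, Real.norm_of_nonneg (hs0 n).le]
    have := mul_le_mul_of_nonneg_left (hs1 n) (norm_nonneg (fderiv ℝ b (s n • y)))
    nlinarith
  · simp only [hder]
    refine squeeze_zero_norm (a := fun n => s n * C) (fun n => ?_) (by simpa using hst.mul_const C)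
    rw [norm_smul, Real.norm_of_nonneg (hs0 n).le]
    exact mul_le_mul_of_nonneg_left (hC1 _) (hs0 n).le

end Cutoff

section Gibbs

variable {d m : ℕ}

lemma integrable_gibbs_iff {β Z : ℝ} (hZ : 0 < Z) {V : (Fin d → ℝ) → ℝ}
    (hV : ContDiff ℝ (⊤ : ℕ∞) V) {F : Xsp d m → ℝ} :
    Integrable F (gibbs d m β Z V)
      ↔ Integrable (fun x => Z⁻¹ * gdens d m β V x * F x) (volX d m) := by
  have hm : Measurable fun x : Xsp d m => ENNReal.ofReal (Z⁻¹ * gdens d m β V x) :=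
    (measurable_const.mul (contDiff_gdens β hV).continuous.measurable).ennreal_ofReal
  rw [gibbs, integrable_withDensity_iff_integrable_smul' hm (by simp)]
  simp_rw [ENNReal.toReal_ofReal (mul_nonneg (inv_nonneg.2 hZ.le) (gdens_pos β V _).le),
    smul_eq_mul]

lemma integral_gibbs {β Z : ℝ} (hZ : 0 < Z) {V : (Fin d → ℝ) → ℝ}
    (hV : ContDiff ℝ (⊤ : ℕ∞) V) (F : Xsp d m → ℝ) :
    ∫ x, F x ∂(gibbs d m β Z V) = ∫ x, Z⁻¹ * gdens d m β V x * F x ∂(volX d m) := by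
  have hm : Measurable fun x : Xsp d m => ENNReal.ofReal (Z⁻¹ * gdens d m β V x) :=
    (measurable_const.mul (contDiff_gdens β hV).continuous.measurable).ennreal_ofReal
  rw [gibbs, integral_withDensity_eq_integral_toReal_smul₀ hm.aemeasurable (by simp)]
  simp_rw [ENNReal.toReal_ofReal (mul_nonneg (inv_nonneg.2 hZ.le) (gdens_pos β V _).le),
    smul_eq_mul]

lemma ae_gibbs_fst_mem_Icc (β Z : ℝ) (V : (Fin d → ℝ) → ℝ) :
    ∀ᵐ x ∂(gibbs d m β Z V), x.1 ∈ Set.Icc (0 : Fin d → ℝ) 1 := by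
  refine (withDensity_absolutelyContinuous (volX d m) _).ae_le ?_
  filter_upwards [ae_restrict_mem measurableSet_fst_mem_cube] with x hx
  exact cube_subset_Icc d hx

lemma integrable_gaussian_pi {ι : Type*} [Fintype ι] {b : ℝ} (hb : 0 < b) :
    Integrable fun v : ι → ℝ => ∏ i, Real.exp (-b * v i ^ 2) :=
  Integrable.fintype_prod fun _ => integrable_exp_neg_mul_sq hb

lemma integrable_gaussian_volX {b : ℝ} (hb : 0 < b) :
    Integrable (fun x : Xsp d m =>
      Real.exp (-b * ((∑ i, x.2.1 i ^ 2) + ∑ j, ∑ i, x.2.2 j i ^ 2))) (volX d m) := by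
  have hz : Integrable fun z : Fin m → Fin d → ℝ => ∏ j, ∏ i, Real.exp (-b * z j i ^ 2) :=
    Integrable.fintype_prod fun _ => integrable_gaussian_pi hb
  have h1 : Integrable (fun _ : Fin d → ℝ => (1 : ℝ)) (volume.restrict (cube d)) := by
    have : IsFiniteMeasure ((volume : Measure (Fin d → ℝ)).restrict (cube d)) :=
      ⟨by
        rw [Measure.restrict_apply_univ]
        exact (measure_mono (cube_subset_Icc d)).trans_lt isCompact_Icc.measure_lt_top⟩
    exact integrable_const 1
  have h := h1.mul_prod ((integrable_gaussian_pi (ι := Fin d) hb).mul_prod hz)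
  rw [volX_eq_prod]
  refine h.congr (Eventually.of_forall fun x => ?_)
  simp only [mul_add, Finset.mul_sum, Real.exp_add, Real.exp_sum, one_mul]

lemma integrable_sq_coord_gibbs {β Z : ℝ} (hβ : 0 < β) (hZ : 0 < Z) {V : (Fin d → ℝ) → ℝ}
    (hV : ContDiff ℝ (⊤ : ℕ∞) V) (j : Fin m) (k : Fin d) :
    Integrable (fun x : Xsp d m => (x.2.2 j k) ^ 2) (gibbs d m β Z V) := by
  rw [integrable_gibbs_iff hZ hV]
  obtain ⟨M, hM⟩ := (isCompact_Icc (a := (0 : Fin d → ℝ)) (b := 1)).exists_bound_of_continuousOn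
    (f := fun q => Real.exp (-β * V q)) (by have := hV.continuous; fun_prop)
  have hcont := (contDiff_gdens (m := m) β hV).continuous
  refine ((integrable_gaussian_volX (d := d) (m := m) (b := β / 4) (by positivity)).const_mul
    (Z⁻¹ * M * (4 / β))).mono' (by fun_prop) ?_
  filter_upwards [ae_restrict_mem measurableSet_fst_mem_cube] with x hx
  have hMx := hM x.1 (cube_subset_Icc d hx)
  rw [Real.norm_of_nonneg (Real.exp_pos _).le] at hMx
  have hg := gdens_pos β V x
  rw [Real.norm_of_nonneg (by positivity)]
  set S := (∑ i, x.2.1 i ^ 2) + ∑ j, ∑ i, x.2.2 j i ^ 2 with hS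
  have hzS : x.2.2 j k ^ 2 ≤ S := by
    have h1 : x.2.2 j k ^ 2 ≤ ∑ i, x.2.2 j i ^ 2 :=
      Finset.single_le_sum (f := fun i => x.2.2 j i ^ 2) (fun i _ => sq_nonneg _)
        (Finset.mem_univ k)
    have h2 : ∑ i, x.2.2 j i ^ 2 ≤ ∑ j, ∑ i, x.2.2 j i ^ 2 :=
      Finset.single_le_sum (f := fun j => ∑ i, x.2.2 j i ^ 2)
        (fun j _ => Finset.sum_nonneg fun i _ => sq_nonneg _) (Finset.mem_univ j)
    have h3 : 0 ≤ ∑ i, x.2.1 i ^ 2 := Finset.sum_nonneg fun i _ => sq_nonneg _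
    linarith
  have hexp : S ≤ 4 / β * Real.exp (β / 4 * S) := by
    have h := Real.add_one_le_exp (β / 4 * S)
    rw [div_mul_eq_mul_div, le_div_iff₀ hβ]
    linarith
  have hgd : gdens d m β V x
      = Real.exp (-β * V x.1) * (Real.exp (-(β / 4) * S) * Real.exp (-(β / 4) * S)) := by
    rw [gdens, ← Real.exp_add, ← Real.exp_add]
    congr 1
    rw [hS]; ring
  have hcancel : Real.exp (-(β / 4) * S) * Real.exp (β / 4 * S) = 1 := by
    rw [← Real.exp_add]; simp
  have hM0 : 0 ≤ M := (Real.exp_pos _).le.trans hMx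
  calc Z⁻¹ * gdens d m β V x * x.2.2 j k ^ 2
      ≤ Z⁻¹ * gdens d m β V x * (4 / β * Real.exp (β / 4 * S)) := by
        gcongr
        exact hzS.trans hexp
    _ = Z⁻¹ * Real.exp (-β * V x.1) * (4 / β) * Real.exp (-(β / 4) * S)
          * (Real.exp (-(β / 4) * S) * Real.exp (β / 4 * S)) := by rw [hgd]; ring
    _ ≤ Z⁻¹ * M * (4 / β) * Real.exp (-(β / 4) * S) := by
        rw [hcancel, mul_one]
        gcongr

lemma exists_ham_bound (lam : Fin m → ℝ) {V : (Fin d → ℝ) → ℝ}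
    (hV : ContDiff ℝ (⊤ : ℕ∞) V) :
    ∃ a : ℝ, ∀ x : Xsp d m, x.1 ∈ Set.Icc (0 : Fin d → ℝ) 1 →
      ‖(ham lam V x).2‖ ≤ a * (1 + ‖x.2‖) := by
  have hVc : Continuous fun q => fun i : Fin d => fderiv ℝ V q (Pi.single i 1) :=
    continuous_pi fun i => (hV.continuous_fderiv (by simp)).clm_apply continuous_const
  obtain ⟨M, hM⟩ := (isCompact_Icc (a := (0 : Fin d → ℝ)) (b := 1)).exists_bound_of_continuousOn
    hVc.continuousOn
  refine ⟨M + ∑ j, ‖lam j‖, fun x hx => ?_⟩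
  have hM0 : 0 ≤ M := (norm_nonneg _).trans (hM x.1 hx)
  have hL : 0 ≤ ∑ j, ‖lam j‖ := Finset.sum_nonneg fun j _ => norm_nonneg _
  have hx0 := norm_nonneg x.2
  have hp : ‖x.2.1‖ ≤ ‖x.2‖ := norm_fst_le x.2
  have hz : ‖x.2.2‖ ≤ ‖x.2‖ := norm_snd_le x.2
  have hLx : (∑ j, ‖lam j‖) * ‖x.2‖ ≤ (M + ∑ j, ‖lam j‖) * (1 + ‖x.2‖) := by nlinarith
  refine norm_prod_le_iff.2 ⟨?_, ?_⟩
  · have h1 : ‖∑ j, lam j • x.2.2 j‖ ≤ (∑ j, ‖lam j‖) * ‖x.2‖ := by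
      rw [Finset.sum_mul]
      refine norm_sum_le_of_le _ fun j _ => ?_
      rw [norm_smul]
      exact mul_le_mul_of_nonneg_left ((norm_le_pi_norm _ j).trans hz) (norm_nonneg _)
    refine (norm_sub_le _ _).trans ((add_le_add (hM x.1 hx) h1).trans ?_)
    nlinarith
  · refine (pi_norm_le_iff_of_nonneg (by positivity)).2 fun j => ?_
    refine le_trans ?_ hLx
    simp only [ham, norm_smul]
    exact mul_le_mul (Finset.single_le_sum (f := fun j => ‖lam j‖) (fun j _ => norm_nonneg _)
      (Finset.mem_univ j)) hp (norm_nonneg _) hL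

end Gibbs

section Energy

variable {d m : ℕ}

lemma sum_mul_sum_add {ι κ : Type*} [Fintype ι] [Fintype κ] (α : ι → ℝ) (a b : ℝ)
    (P T : ι → κ → ℝ) :
    ∑ j, α j * ∑ k, (a * P j k + b * T j k)
      = a * ∑ j, α j * ∑ k, P j k + b * ∑ j, α j * ∑ k, T j k := by
  simp only [Finset.sum_add_distrib, Finset.mul_sum, mul_add, mul_left_comm]

lemma contDiff_pZ {w : Xsp d m → ℝ} (hw : ContDiff ℝ (⊤ : ℕ∞) w) (j : Fin m) (k : Fin d) :
    ContDiff ℝ 1 (pZ d m j k w) :=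
  (hw.fderiv_right (m := 1) (by norm_cast)).clm_apply contDiff_const

/-- The integrand obtained by testing `𝓛w = -s z_i·e` against `η w`. -/
def energyDensity (β s : ℝ) (α lam : Fin m → ℝ) (V : (Fin d → ℝ) → ℝ) (i : Fin m)
    (e : Fin d → ℝ) (w η : Xsp d m → ℝ) (x : Xsp d m) : ℝ :=
  β⁻¹ * ∑ j, α j * ∑ k, (η x * pZ d m j k w x ^ 2 + w x * pZ d m j k w x * pZ d m j k η x)
    - 1 / 2 * w x ^ 2 * fderiv ℝ η x (ham lam V x)
    + s * β⁻¹ * ∑ k, e k * (η x * pZ d m i k w x + w x * pZ d m i k η x)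

lemma gdens_mul_energyDensity {β s : ℝ} (hβ : 0 < β) {α lam : Fin m → ℝ} {V : (Fin d → ℝ) → ℝ}
    (hV : ContDiff ℝ (⊤ : ℕ∞) V) {i : Fin m} {e : Fin d → ℝ} {w η : Xsp d m → ℝ}
    (hw : ContDiff ℝ (⊤ : ℕ∞) w) (hη : ContDiff ℝ 1 η) (x : Xsp d m)
    (hgen : gen d m β α lam V w x = -s * ∑ k, e k * x.2.2 i k) :
    gdens d m β V x * energyDensity β s α lam V i e w η x
      = -(1 / 2) * fderiv ℝ (fun x => η x * (w x * (w x * gdens d m β V x))) x (ham lam V x)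
        + β⁻¹ * ∑ j, α j * ∑ k, fderiv ℝ
            (fun x => η x * (w x * (gdens d m β V x * pZ d m j k w x))) x
              (zdir d m j (Pi.single k 1))
        + s * β⁻¹ * ∑ k, e k * fderiv ℝ (fun x => η x * (w x * gdens d m β V x)) x
              (zdir d m i (Pi.single k 1)) := by
  have hwx : DifferentiableAt ℝ w x := hw.differentiable (by simp) x
  have hηx : DifferentiableAt ℝ η x := hη.differentiable one_ne_zero x
  have hρx : DifferentiableAt ℝ (gdens d m β V) x :=
    (contDiff_gdens β hV).differentiable (by simp) x
  have hwρ := hwx.fun_mul hρx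
  have hax : ∀ j k, DifferentiableAt ℝ (pZ d m j k w) x :=
    fun j k => (contDiff_pZ hw j k).differentiable one_ne_zero x
  have h1 : ∀ j k, fderiv ℝ (fun x => η x * (w x * (gdens d m β V x * pZ d m j k w x))) x
      (zdir d m j (Pi.single k 1))
      = gdens d m β V x
          * (η x * pZ d m j k w x ^ 2 + w x * pZ d m j k w x * pZ d m j k η x)
        + (-β * (η x * w x * gdens d m β V x)) * (x.2.2 j k * pZ d m j k w x
          - β⁻¹ * fderiv ℝ (pZ d m j k w) x (zdir d m j (Pi.single k 1))) := by
    intro j k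
    rw [fderiv_fun_mul_apply hηx (hwx.fun_mul (hρx.fun_mul (hax j k))),
      fderiv_fun_mul_apply hwx (hρx.fun_mul (hax j k)), fderiv_fun_mul_apply hρx (hax j k),
      fderiv_gdens_zdir β hV]
    simp only [← pZ.eq_1]
    field_simp
    ring
  have h2 : ∀ k, fderiv ℝ (fun x => η x * (w x * gdens d m β V x)) x
      (zdir d m i (Pi.single k 1))
      = gdens d m β V x * (η x * pZ d m i k w x + w x * pZ d m i k η x)
        + (-β * (η x * w x * gdens d m β V x)) * x.2.2 i k := by
    intro k
    rw [fderiv_fun_mul_apply hηx hwρ, fderiv_fun_mul_apply hwx hρx, fderiv_gdens_zdir β hV]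
    simp only [← pZ.eq_1]
    ring
  have h3 : fderiv ℝ (fun x => η x * (w x * (w x * gdens d m β V x))) x (ham lam V x)
      = 2 * η x * w x * gdens d m β V x * fderiv ℝ w x (ham lam V x)
        + w x ^ 2 * gdens d m β V x * fderiv ℝ η x (ham lam V x) := by
    rw [fderiv_fun_mul_apply hηx (hwx.fun_mul hwρ), fderiv_fun_mul_apply hwx hwρ,
      fderiv_fun_mul_apply hwx hρx, fderiv_gdens_ham β lam hV]
    ring
  have h4 := sum_mul_sum_add (fun _ : Unit => 1) (gdens d m β V x)
    (-β * (η x * w x * gdens d m β V x))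
    (fun _ k => e k * (η x * pZ d m i k w x + w x * pZ d m i k η x))
    (fun _ k => e k * x.2.2 i k)
  simp only [Finset.univ_unique, Finset.sum_singleton, one_mul] at h4
  have h5 : ∀ k, e k * (gdens d m β V x * (η x * pZ d m i k w x + w x * pZ d m i k η x)
        + (-β * (η x * w x * gdens d m β V x)) * x.2.2 i k)
      = gdens d m β V x * (e k * (η x * pZ d m i k w x + w x * pZ d m i k η x))
        + (-β * (η x * w x * gdens d m β V x)) * (e k * x.2.2 i k) := fun k => by ring
  rw [gen_eq] at hgen
  simp only [h1, h2, h3, h5, h4, sum_mul_sum_add, energyDensity]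
  generalize (∑ j, α j * ∑ k, (x.2.2 j k * pZ d m j k w x
    - β⁻¹ * fderiv ℝ (pZ d m j k w) x (zdir d m j (Pi.single k 1)))) = T at *
  have hT : T = -s * ∑ k, e k * x.2.2 i k - fderiv ℝ w x (ham lam V x) := by linarith
  rw [hT]
  field_simp
  ring

lemma integral_energyDensity_eq_zero {n : ℕ} {β s Z : ℝ} (hβ : 0 < β) (hZ : 0 < Z)
    {α lam : Fin m → ℝ} {V : (Fin (n + 1) → ℝ) → ℝ} (hV : ContDiff ℝ (⊤ : ℕ∞) V)
    (hVper : PerV (n + 1) V) {i : Fin m} {e : Fin (n + 1) → ℝ} {w η : Xsp (n + 1) m → ℝ}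
    (hw : ContDiff ℝ (⊤ : ℕ∞) w) (hwper : PerQ (n + 1) m w) (hη : ContDiff ℝ 1 η)
    (hηper : PerQ (n + 1) m η)
    {K : Set ((Fin (n + 1) → ℝ) × (Fin m → Fin (n + 1) → ℝ))} (hK : IsCompact K)
    (h0 : ∀ x : Xsp (n + 1) m, x.2 ∉ K → η x = 0)
    (hgen : ∀ x, gen (n + 1) m β α lam V w x = -s * ∑ k, e k * x.2.2 i k) :
    ∫ x, energyDensity β s α lam V i e w η x ∂(gibbs (n + 1) m β Z V) = 0 := by
  have hw1 : ContDiff ℝ 1 w := hw.of_le (by norm_cast)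
  have hρ : ContDiff ℝ 1 (gdens (n + 1) m β V) := (contDiff_gdens β hV).of_le (by norm_cast)
  have hρper := perQ_gdens (m := m) β hVper
  have h : NullMean (volX (n + 1) m)
      fun x => gdens (n + 1) m β V x * energyDensity β s α lam V i e w η x := by
    simp only [fun x => gdens_mul_energyDensity (i := i) (e := e) hβ hV hw hη x (hgen x)]
    refine (NullMean.add (NullMean.const_mul _ ?_) (NullMean.const_mul _ ?_)).add
      (NullMean.const_mul _ ?_)
    · refine nullMean_fderiv_ham lam hV (hη.mul (hw1.mul (hw1.mul hρ))) (fun l x => ?_) hK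
        fun x hx => by simp [h0 x hx]
      simp only [hηper l x, hwper l x, hρper l x]
    · refine NullMean.sum fun j _ => NullMean.const_mul _ (NullMean.sum fun k _ => ?_)
      exact nullMean_fderiv_fiber (hη.mul (hw1.mul (hρ.mul (contDiff_pZ hw j k)))) hK
        (fun x hx => by simp [h0 x hx]) _
    · refine NullMean.sum fun k _ => NullMean.const_mul _ ?_
      exact nullMean_fderiv_fiber (hη.mul (hw1.mul hρ)) hK (fun x hx => by simp [h0 x hx]) _
  rw [integral_gibbs hZ hV]
  simp only [mul_assoc]
  rw [integral_const_mul, h.2, mul_zero]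

lemma fderiv_comp_snd {χ : (Fin d → ℝ) × (Fin m → Fin d → ℝ) → ℝ} (hχ : ContDiff ℝ 1 χ)
    (x v : Xsp d m) : fderiv ℝ (fun x : Xsp d m => χ x.2) x v = fderiv ℝ χ x.2 v.2 := by
  have := HasFDerivAt.comp (g := χ) (f := fun x : Xsp d m => x.2) x
    (hχ.differentiable one_ne_zero x.2).hasFDerivAt hasFDerivAt_snd
  rw [show (fun x : Xsp d m => χ x.2) = χ ∘ fun x : Xsp d m => x.2 from rfl, this.fderiv]
  rfl

/-- Removal of a cutoff: the terms carrying a derivative of the cutoff vanish in the limit. -/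
lemma tendsto_integral_cutoff {Ω E ι : Type*} [MeasurableSpace Ω] {μ : Measure Ω}
    [NormedAddCommGroup E] [NormedSpace ℝ E] [Fintype ι]
    {χ : ℕ → E → ℝ} {C : ℝ} (hχ1 : ∀ n y, |χ n y| ≤ 1)
    (hχt : ∀ y, Tendsto (fun n => χ n y) atTop (nhds 1))
    (hχ' : ∀ n y, ‖fderiv ℝ (χ n) y‖ * (1 + ‖y‖) ≤ C)
    (hχt' : ∀ y, Tendsto (fun n => fderiv ℝ (χ n) y) atTop (nhds 0))
    {Y : Ω → E} {P : Ω → ℝ} {h : ι → Ω → ℝ} {v : ι → Ω → E} {a : ι → ℝ}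
    (hP : Integrable P μ) (hh : ∀ l, Integrable (h l) μ)
    (hv : ∀ l, ∀ᵐ x ∂μ, ‖v l x‖ ≤ a l * (1 + ‖Y x‖))
    (hmeas : ∀ n, AEStronglyMeasurable
      (fun x => χ n (Y x) * P x + ∑ l, h l x * fderiv ℝ (χ n) (Y x) (v l x)) μ) :
    Tendsto (fun n => ∫ x, (χ n (Y x) * P x + ∑ l, h l x * fderiv ℝ (χ n) (Y x) (v l x)) ∂μ)
      atTop (nhds (∫ x, P x ∂μ)) := by
  refine tendsto_integral_of_dominated_convergence
    (fun x => |P x| + ∑ l, |h l x| * (|a l| * C)) hmeas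
    (hP.abs.add (integrable_finsetSum _ fun l _ => (hh l).abs.mul_const _)) (fun n => ?_) ?_
  · filter_upwards [ae_all_iff.2 hv] with x hx
    rw [Real.norm_eq_abs]
    refine (abs_add_le _ _).trans (add_le_add ?_ ((Finset.abs_sum_le_sum_abs _ _).trans
      (Finset.sum_le_sum fun l _ => ?_)))
    · rw [abs_mul]
      exact mul_le_of_le_one_left (abs_nonneg _) (hχ1 _ _)
    · rw [abs_mul]
      refine mul_le_mul_of_nonneg_left ?_ (abs_nonneg _)
      have hY : 0 ≤ 1 + ‖Y x‖ := by positivity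
      calc |fderiv ℝ (χ n) (Y x) (v l x)| ≤ ‖fderiv ℝ (χ n) (Y x)‖ * ‖v l x‖ :=
            (fderiv ℝ (χ n) (Y x)).le_opNorm _
        _ ≤ ‖fderiv ℝ (χ n) (Y x)‖ * (|a l| * (1 + ‖Y x‖)) := by
            gcongr
            exact (hx l).trans (mul_le_mul_of_nonneg_right (le_abs_self _) hY)
        _ = |a l| * (‖fderiv ℝ (χ n) (Y x)‖ * (1 + ‖Y x‖)) := by ring
        _ ≤ |a l| * C := mul_le_mul_of_nonneg_left (hχ' _ _) (abs_nonneg _)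
  · refine Eventually.of_forall fun x => ?_
    have h1 : ∀ l, Tendsto (fun n => h l x * fderiv ℝ (χ n) (Y x) (v l x)) atTop (nhds 0) := by
      intro l
      have := ((ContinuousLinearMap.apply ℝ ℝ (v l x)).continuous.tendsto 0).comp (hχt' (Y x))
      simpa using this.const_mul (h l x)
    simpa using ((hχt (Y x)).mul_const (P x)).add (tendsto_finsetSum Finset.univ fun l _ => h1 l)

lemma continuous_ham (lam : Fin m → ℝ) {V : (Fin d → ℝ) → ℝ} (hV : ContDiff ℝ (⊤ : ℕ∞) V) :
    Continuous (ham (d := d) lam V) := by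
  have h : Continuous fun q => fun i : Fin d => fderiv ℝ V q (Pi.single i 1) :=
    continuous_pi fun i => (hV.continuous_fderiv (by simp)).clm_apply continuous_const
  have h' : Continuous fun x : Xsp d m => fun i : Fin d => fderiv ℝ V x.1 (Pi.single i 1) :=
    h.comp continuous_fst
  exact (continuous_fst.comp continuous_snd).neg.prodMk
    ((h'.sub (by fun_prop)).prodMk (by fun_prop))

/-- The energy identity `⟨w, 𝓛w⟩ = β⁻¹ ∑ⱼ αⱼ ‖∇_{z_j} w‖²`, for `𝓛w = -s z_i·e`. -/
lemma integral_energy_eq_zero {n : ℕ} {β s Z : ℝ} (hβ : 0 < β) (hZ : 0 < Z)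
    {α lam : Fin m → ℝ} {V : (Fin (n + 1) → ℝ) → ℝ} (hV : ContDiff ℝ (⊤ : ℕ∞) V)
    (hVper : PerV (n + 1) V) {i : Fin m} {e : Fin (n + 1) → ℝ} {w : Xsp (n + 1) m → ℝ}
    (hw : ContDiff ℝ (⊤ : ℕ∞) w) (hwper : PerQ (n + 1) m w)
    [IsFiniteMeasure (gibbs (n + 1) m β Z V)]
    (hwL2 : MemLp w 2 (gibbs (n + 1) m β Z V))
    (hwZ : ∀ j k, MemLp (pZ (n + 1) m j k w) 2 (gibbs (n + 1) m β Z V))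
    (hgen : ∀ x, gen (n + 1) m β α lam V w x = -s * ∑ k, e k * x.2.2 i k) :
    ∫ x, (β⁻¹ * ∑ j, α j * ∑ k, pZ (n + 1) m j k w x ^ 2
      + s * β⁻¹ * ∑ k, e k * pZ (n + 1) m i k w x) ∂(gibbs (n + 1) m β Z V) = 0 := by
  obtain ⟨χ, C, hχ, hχc, hχ1, hχt, hχ', hχt'⟩ :=
    exists_cutoff ((Fin (n + 1) → ℝ) × (Fin m → Fin (n + 1) → ℝ))
  obtain ⟨a, ha⟩ := exists_ham_bound (d := n + 1) lam hV
  let h : (Fin m × Fin (n + 1)) ⊕ Fin (n + 1) ⊕ Unit → Xsp (n + 1) m → ℝ :=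
    Sum.elim (fun jk x => β⁻¹ * α jk.1 * (w x * pZ (n + 1) m jk.1 jk.2 w x))
      (Sum.elim (fun k x => s * β⁻¹ * e k * w x) fun _ x => -(1 / 2) * w x ^ 2)
  let v : (Fin m × Fin (n + 1)) ⊕ Fin (n + 1) ⊕ Unit → Xsp (n + 1) m →
      (Fin (n + 1) → ℝ) × (Fin m → Fin (n + 1) → ℝ) :=
    Sum.elim (fun jk _ => (zdir (n + 1) m jk.1 (Pi.single jk.2 1)).2)
      (Sum.elim (fun k _ => (zdir (n + 1) m i (Pi.single k 1)).2) fun _ x => (ham lam V x).2)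
  let b : (Fin m × Fin (n + 1)) ⊕ Fin (n + 1) ⊕ Unit → ℝ :=
    Sum.elim (fun jk => ‖(zdir (n + 1) m jk.1 (Pi.single jk.2 1)).2‖)
      (Sum.elim (fun k => ‖(zdir (n + 1) m i (Pi.single k 1)).2‖) fun _ => a)
  have hP : Integrable (fun x => β⁻¹ * ∑ j, α j * ∑ k, pZ (n + 1) m j k w x ^ 2
      + s * β⁻¹ * ∑ k, e k * pZ (n + 1) m i k w x) (gibbs (n + 1) m β Z V) :=
    ((integrable_finsetSum _ fun j _ => (integrable_finsetSum _ fun k _ =>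
      (hwZ j k).integrable_sq).const_mul _).const_mul _).add
      ((integrable_finsetSum _ fun k _ =>
        ((hwZ i k).integrable one_le_two).const_mul _).const_mul _)
  have hh : ∀ l, Integrable (h l) (gibbs (n + 1) m β Z V) := by
    rintro (⟨j, k⟩ | k | _)
    · exact (hwL2.integrable_mul (hwZ j k)).const_mul _
    · exact (hwL2.integrable one_le_two).const_mul _
    · exact hwL2.integrable_sq.const_mul _
  have hv : ∀ l, ∀ᵐ x ∂(gibbs (n + 1) m β Z V), ‖v l x‖ ≤ b l * (1 + ‖x.2‖) := by
    rintro (⟨j, k⟩ | k | _)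
    · exact Eventually.of_forall fun x =>
        le_mul_of_one_le_right (norm_nonneg _) (by linarith [norm_nonneg x.2])
    · exact Eventually.of_forall fun x =>
        le_mul_of_one_le_right (norm_nonneg _) (by linarith [norm_nonneg x.2])
    · filter_upwards [ae_gibbs_fst_mem_Icc β Z V] with x hx using ha x hx
  have hvc : ∀ l, Continuous (v l) := by
    rintro (⟨j, k⟩ | k | _)
    · exact continuous_const
    · exact continuous_const
    · exact (continuous_ham lam hV).snd
  have heq : ∀ N x, energyDensity β s α lam V i e w (fun x => χ N x.2) x
      = χ N x.2 * (β⁻¹ * ∑ j, α j * ∑ k, pZ (n + 1) m j k w x ^ 2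
          + s * β⁻¹ * ∑ k, e k * pZ (n + 1) m i k w x)
        + ∑ l, h l x * fderiv ℝ (χ N) x.2 (v l x) := by
    intro N x
    have hp : ∀ j k, pZ (n + 1) m j k (fun x => χ N x.2) x
        = fderiv ℝ (χ N) x.2 (zdir (n + 1) m j (Pi.single k 1)).2 :=
      fun j k => fderiv_comp_snd (hχ N) _ _
    simp only [energyDensity, fderiv_comp_snd (hχ N), hp, Fintype.sum_sum_type,
      Fintype.sum_prod_type, h, v, Sum.elim_inl, Sum.elim_inr, Finset.univ_unique,
      Finset.sum_singleton, Finset.mul_sum, mul_add, Finset.sum_add_distrib]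
    have hA : ∀ j k, β⁻¹ * (α j * (χ N x.2 * pZ (n + 1) m j k w x ^ 2))
        = χ N x.2 * (β⁻¹ * (α j * pZ (n + 1) m j k w x ^ 2)) := fun j k => by ring
    have hB : ∀ j k (t : ℝ), β⁻¹ * (α j * (w x * pZ (n + 1) m j k w x * t))
        = β⁻¹ * α j * (w x * pZ (n + 1) m j k w x) * t := fun j k t => by ring
    have hC : ∀ k, s * β⁻¹ * (e k * (χ N x.2 * pZ (n + 1) m i k w x))
        = χ N x.2 * (s * β⁻¹ * (e k * pZ (n + 1) m i k w x)) := fun k => by ring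
    have hD : ∀ k (t : ℝ), s * β⁻¹ * (e k * (w x * t)) = s * β⁻¹ * e k * w x * t :=
      fun k t => by ring
    simp only [hA, hB, hC, hD]
    ring
  have hmeas : ∀ N, AEStronglyMeasurable (fun x : Xsp (n + 1) m =>
      χ N x.2 * (β⁻¹ * ∑ j, α j * ∑ k, pZ (n + 1) m j k w x ^ 2
        + s * β⁻¹ * ∑ k, e k * pZ (n + 1) m i k w x)
      + ∑ l, h l x * fderiv ℝ (χ N) x.2 (v l x)) (gibbs (n + 1) m β Z V) := by
    intro N
    refine AEStronglyMeasurable.add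
      (((hχ N).continuous.comp continuous_snd).aestronglyMeasurable.mul hP.1)
      (Finset.aestronglyMeasurable_fun_sum _ fun l _ => (hh l).1.mul
        (Continuous.aestronglyMeasurable ?_))
    exact (((hχ N).continuous_fderiv one_ne_zero).comp continuous_snd).clm_apply (hvc l)
  have hlim := tendsto_integral_cutoff hχ1 hχt hχ' hχt' hP hh hv hmeas
  simp only [← heq] at hlim
  have hzero : ∀ N, ∫ x, energyDensity β s α lam V i e w (fun x => χ N x.2) x
      ∂(gibbs (n + 1) m β Z V) = 0 := fun N =>
    integral_energyDensity_eq_zero hβ hZ hV hVper hw hwper ((hχ N).comp contDiff_snd)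
      (fun _ _ => rfl) (hχc N) (fun x hx => image_eq_zero_of_notMem_tsupport hx) hgen
  simp only [hzero] at hlim
  exact tendsto_nhds_unique hlim tendsto_const_nhds

end Energy

section Shift

variable {d m : ℕ}

/-- The linear functional `x ↦ c z_i·e`. -/
def zlin (i : Fin m) (c : ℝ) (e : Fin d → ℝ) : Xsp d m →L[ℝ] ℝ :=
  c • ∑ k, e k • zcoord d m i k

lemma zlin_apply (i : Fin m) (c : ℝ) (e : Fin d → ℝ) (x : Xsp d m) :
    zlin i c e x = c * ∑ k, e k * x.2.2 i k := by
  simp [zlin]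

lemma zlin_zdir (i j : Fin m) (c : ℝ) (e : Fin d → ℝ) (k : Fin d) :
    zlin i c e (zdir d m j (Pi.single k 1)) = if j = i then c * e k else 0 := by
  rw [zlin_apply]
  split_ifs with h
  · subst h; simp [zdir, Pi.single_apply]
  · simp [zdir, Function.update_of_ne (Ne.symm h)]

lemma fderiv_sub_zlin {φ : Xsp d m → ℝ} (hφ : ContDiff ℝ (⊤ : ℕ∞) φ) (i : Fin m) (c : ℝ)
    (e : Fin d → ℝ) (x : Xsp d m) :
    fderiv ℝ (fun x => φ x - zlin i c e x) x = fderiv ℝ φ x - zlin i c e :=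
  ((hφ.differentiable (by simp) x).hasFDerivAt.sub (zlin i c e).hasFDerivAt).fderiv

lemma pZ_sub_zlin {φ : Xsp d m → ℝ} (hφ : ContDiff ℝ (⊤ : ℕ∞) φ) (i j : Fin m) (c : ℝ)
    (e : Fin d → ℝ) (k : Fin d) :
    pZ d m j k (fun x => φ x - zlin i c e x)
      = fun x => pZ d m j k φ x - if j = i then c * e k else 0 := by
  funext x
  rw [pZ, fderiv_sub_zlin hφ, sub_apply, zlin_zdir, pZ]

lemma gen_sub_zlin {β : ℝ} {α lam : Fin m → ℝ} {V : (Fin d → ℝ) → ℝ} {φ : Xsp d m → ℝ}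
    (hφ : ContDiff ℝ (⊤ : ℕ∞) φ) (i : Fin m) (c : ℝ) (e : Fin d → ℝ) (x : Xsp d m) :
    gen d m β α lam V (fun x => φ x - zlin i c e x) x = gen d m β α lam V φ x
      - c * lam i * ∑ k, x.2.1 k * e k - α i * c * ∑ k, e k * x.2.2 i k := by
  have h1 : ∑ j, α j * ∑ k, x.2.2 j k * (if j = i then c * e k else 0)
      = α i * c * ∑ k, e k * x.2.2 i k := by
    rw [Finset.sum_eq_single i (fun j _ hj => by simp [hj]) (by simp), mul_assoc]
    simp only [if_true, Finset.mul_sum]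
    exact Finset.sum_congr rfl fun k _ => by ring
  have h2 : zlin i c e (ham lam V x) = c * lam i * ∑ k, x.2.1 k * e k := by
    rw [zlin_apply, mul_assoc, Finset.mul_sum (a := lam i)]
    congr 1
    exact Finset.sum_congr rfl fun k _ => by simp [ham]; ring
  rw [gen_eq, gen_eq, fderiv_sub_zlin hφ, sub_apply, h2, ← h1]
  simp only [pZ_sub_zlin hφ, fderiv_sub_const, mul_sub, Finset.sum_sub_distrib]
  ring

/-- Completing the square in the energy density of `φ - c z_i·e`. -/
lemma energy_shift_le {α : Fin m → ℝ} (hα : ∀ j, 0 < α j) {β : ℝ} (hβ : 0 < β) {e : Fin d → ℝ}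
    (he : ∑ i, (e i) ^ 2 = 1) (i : Fin m) (c : ℝ) (a b : Fin m → Fin d → ℝ)
    (hab : ∀ j k, b j k = a j k - if j = i then c * e k else 0) :
    β⁻¹ * ∑ j, α j * ∑ k, a j k ^ 2 ≤ 2 * (β⁻¹ * ∑ j, α j * ∑ k, b j k ^ 2
      + α i * c * β⁻¹ * ∑ k, e k * b i k) + β⁻¹ * (α i * c ^ 2) := by
  have h0 : 0 ≤ ∑ j, α j * ∑ k, b j k ^ 2 :=
    Finset.sum_nonneg fun j _ => mul_nonneg (hα j).le (Finset.sum_nonneg fun k _ => sq_nonneg _)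
  have h1 : ∀ j, α j * ∑ k, a j k ^ 2 = α j * ∑ k, b j k ^ 2
      + if j = i then α i * (2 * c * ∑ k, e k * b i k + c ^ 2) else 0 := by
    intro j
    split_ifs with h
    · subst h
      have h2 : ∀ k, a j k ^ 2 = b j k ^ 2 + 2 * c * (e k * b j k) + c ^ 2 * e k ^ 2 := by
        intro k
        rw [hab, if_pos rfl]
        ring
      simp only [h2, Finset.sum_add_distrib, ← Finset.mul_sum, he]
      ring
    · simp [hab, h]
  have h3 : ∑ j, α j * ∑ k, a j k ^ 2 = ∑ j, α j * ∑ k, b j k ^ 2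
      + α i * (2 * c * ∑ k, e k * b i k + c ^ 2) := by
    simp only [h1, Finset.sum_add_distrib, Finset.sum_ite_eq', Finset.mem_univ, if_true]
  rw [h3]
  have := mul_nonneg (inv_nonneg.2 hβ.le) h0
  linarith

end Shift

section Bound

variable {d m : ℕ}

lemma memLp_two_of_iteratedFDeriv {μ : Measure (Xsp d m)} {φ : Xsp d m → ℝ}
    (hφ : ContDiff ℝ (⊤ : ℕ∞) φ)
    (hφL2 : ∀ (n : ℕ) (v : Fin n → Xsp d m),
      Integrable (fun x => (iteratedFDeriv ℝ n φ x v) ^ 2) μ) :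
    MemLp φ 2 μ ∧ ∀ v, MemLp (fun x => fderiv ℝ φ x v) 2 μ := by
  refine ⟨(memLp_two_iff_integrable_sq hφ.continuous.aestronglyMeasurable).2
    (by simpa using hφL2 0 0), fun v => (memLp_two_iff_integrable_sq ?_).2
    (by simpa [iteratedFDeriv_one_apply] using hφL2 1 fun _ => v)⟩
  exact ((hφ.continuous_fderiv (by simp)).clm_apply continuous_const).aestronglyMeasurable

lemma memLp_zlin_gibbs {β Z : ℝ} (hβ : 0 < β) (hZ : 0 < Z) {V : (Fin d → ℝ) → ℝ}
    (hV : ContDiff ℝ (⊤ : ℕ∞) V) (i : Fin m) (c : ℝ) (e : Fin d → ℝ) :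
    MemLp (zlin i c e) 2 (gibbs d m β Z V) := by
  have h : MemLp (fun x : Xsp d m => c * ∑ k, e k * x.2.2 i k) 2 (gibbs d m β Z V) := by
    refine (memLp_finsetSum _ fun k _ => MemLp.const_mul ?_ (e k)).const_mul c
    exact (memLp_two_iff_integrable_sq (zcoord d m i k).continuous.aestronglyMeasurable).2
      (integrable_sq_coord_gibbs hβ hZ hV i k)
  simpa only [← zlin_apply] using h

end Bound

/-- (Upper bound on the effective diffusion coefficient.) Assume
`V ∈ C^∞(𝕋^d)`, let `e` be a unit vector and let `φ` (smooth, with all derivatives in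
`L²(μ_β)`) solve `𝓛φ = p·e`. Then
`D^e = β⁻¹ Σ_j α_j ∫ |∇_{z_j}φ|² dμ_β ≤ (4/β) Σ_i α_i/λ_i²`. -/
theorem diffusion_upper_bound
    (d m : ℕ) (hd : 1 ≤ d) (hm : 1 ≤ m)
    (β : ℝ) (hβ : 0 < β)
    (α lam : Fin m → ℝ) (hα : ∀ j, 0 < α j) (hlam : ∀ j, 0 < lam j)
    (V : (Fin d → ℝ) → ℝ) (hV : ContDiff ℝ (⊤ : ℕ∞) V) (hVper : PerV d V)
    (Z : ℝ) (hZ : 0 < Z)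
    (hprob : IsProbabilityMeasure (gibbs d m β Z V))
    (e : Fin d → ℝ) (he : ∑ i, (e i) ^ 2 = 1)
    (φ : Xsp d m → ℝ) (hφ : ContDiff ℝ (⊤ : ℕ∞) φ) (hφper : PerQ d m φ)
    (hφL2 : ∀ (n : ℕ) (v : Fin n → Xsp d m),
      Integrable (fun x => (iteratedFDeriv ℝ n φ x v) ^ 2) (gibbs d m β Z V))
    (hpoisson : ∀ x, gen d m β α lam V φ x = ∑ i, x.2.1 i * e i) :
    β⁻¹ * ∑ j, α j * ∫ x, ∑ k, (pZ d m j k φ x) ^ 2 ∂(gibbs d m β Z V)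
      ≤ (4 / β) * ∑ i, α i / (lam i) ^ 2 := by
  obtain ⟨n, rfl⟩ : ∃ n, d = n + 1 := ⟨d - 1, by omega⟩
  let i : Fin m := ⟨0, hm⟩
  let c := (lam i)⁻¹
  let w : Xsp (n + 1) m → ℝ := fun x => φ x - zlin i c e x
  have hc : c * lam i = 1 := inv_mul_cancel₀ (hlam i).ne'
  have hb : ∀ j k, pZ (n + 1) m j k w
      = fun x => pZ (n + 1) m j k φ x - if j = i then c * e k else 0 :=
    fun j k => pZ_sub_zlin hφ i j c e k
  obtain ⟨hL2, hL2'⟩ := memLp_two_of_iteratedFDeriv hφ hφL2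
  have hZφ : ∀ j k, MemLp (pZ (n + 1) m j k φ) 2 (gibbs (n + 1) m β Z V) := fun j k => hL2' _
  have hZw : ∀ j k, MemLp (pZ (n + 1) m j k w) 2 (gibbs (n + 1) m β Z V) := fun j k => by
    rw [hb]
    exact (hZφ j k).sub (memLp_const _)
  have hw : ContDiff ℝ (⊤ : ℕ∞) w := hφ.sub (zlin i c e).contDiff
  have hwper : PerQ (n + 1) m w := fun k x => by
    simp only [w, zlin_apply, hφper k x]
  have hgen : ∀ x, gen (n + 1) m β α lam V w x = -(α i * c) * ∑ k, e k * x.2.2 i k := fun x => by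
    rw [gen_sub_zlin hφ, hpoisson, hc]
    ring
  have henergy := integral_energy_eq_zero hβ hZ hV hVper hw hwper
    (hL2.sub (memLp_zlin_gibbs hβ hZ hV i c e)) hZw hgen
  have hsq : ∀ j, Integrable (fun x => ∑ k, pZ (n + 1) m j k φ x ^ 2)
      (gibbs (n + 1) m β Z V) := fun j => integrable_finsetSum _ fun k _ => (hZφ j k).integrable_sq
  have hP : Integrable (fun x => β⁻¹ * ∑ j, α j * ∑ k, pZ (n + 1) m j k w x ^ 2
      + α i * c * β⁻¹ * ∑ k, e k * pZ (n + 1) m i k w x) (gibbs (n + 1) m β Z V) :=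
    ((integrable_finsetSum _ fun j _ => (integrable_finsetSum _ fun k _ =>
      (hZw j k).integrable_sq).const_mul _).const_mul _).add
      ((integrable_finsetSum _ fun k _ =>
        ((hZw i k).integrable one_le_two).const_mul _).const_mul _)
  have hi : α i / lam i ^ 2 ≤ ∑ j, α j / lam j ^ 2 :=
    Finset.single_le_sum (f := fun j => α j / lam j ^ 2)
      (fun j _ => div_nonneg (hα j).le (sq_nonneg _)) (Finset.mem_univ i)
  have hi0 : 0 ≤ α i / lam i ^ 2 := div_nonneg (hα i).le (sq_nonneg _)
  calc β⁻¹ * ∑ j, α j * ∫ x, ∑ k, (pZ (n + 1) m j k φ x) ^ 2 ∂(gibbs (n + 1) m β Z V)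
      = ∫ x, β⁻¹ * ∑ j, α j * ∑ k, pZ (n + 1) m j k φ x ^ 2 ∂(gibbs (n + 1) m β Z V) := by
        rw [integral_const_mul, integral_finsetSum _ fun j _ => (hsq j).const_mul (α j)]
        simp only [integral_const_mul]
    _ ≤ ∫ x, (2 * (β⁻¹ * ∑ j, α j * ∑ k, pZ (n + 1) m j k w x ^ 2
          + α i * c * β⁻¹ * ∑ k, e k * pZ (n + 1) m i k w x) + β⁻¹ * (α i * c ^ 2))
          ∂(gibbs (n + 1) m β Z V) := by
        refine integral_mono ((integrable_finsetSum _ fun j _ =>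
          (hsq j).const_mul (α j)).const_mul _)
          ((hP.const_mul 2).add (integrable_const _)) fun x => ?_
        exact energy_shift_le hα hβ he i c _ _ fun j k => congrFun (hb j k) x
    _ = β⁻¹ * (α i / lam i ^ 2) := by
        rw [integral_add (hP.const_mul 2) (integrable_const _), integral_const_mul, henergy]
        simp [c, div_eq_mul_inv]
    _ ≤ (4 / β) * ∑ i, α i / (lam i) ^ 2 := by
        rw [div_eq_mul_inv 4 β, mul_comm 4, mul_assoc]
        refine mul_le_mul_of_nonneg_left ?_ (inv_nonneg.2 hβ.le)
        linarith
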